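/- Let X be a nonempty finite set, let μ, σ : X → ℝ with σ(x) > 0 for all x ∈ X, and let y⋆ ∈ ℝ. Define γ(x) = (y⋆ − μ(x))/σ(x). Then a point x ∈ X maximizes g(γ(x)) over X if and only if it minimizes γ(x) over X. (In other words, MES with a single sample y⋆ selects exactly the same points as EST with m = y⋆.) -/

import Mathlib

open Real

/-- The standard normal probability density function. -/
noncomputable def normalPdf (u : ℝ) : ℝ := (Real.sqrt (2 * Real.pi))⁻¹ * Real.exp (-u ^ 2 / 2)

/-- The standard normal cumulative distribution function. -/
noncomputable def normalCdf (u : ℝ) : ℝ := ∫ t in Set.Iic u, normalPdf t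

/-- The per-sample MES acquisition value. -/
noncomputable def mesG (u : ℝ) : ℝ :=
  u * normalPdf u / (2 * normalCdf u) - Real.log (normalCdf u)

lemma aux_cont : Continuous normalPdf := by
  unfold normalPdf; fun_prop

lemma aux_pos (u : ℝ) : 0 < normalPdf u := by
  unfold normalPdf; positivity

lemma aux_le_one (u : ℝ) : normalPdf u ≤ 1 := by
  unfold normalPdf
  have h1 : (1:ℝ) ≤ Real.sqrt (2 * Real.pi) := by
    rw [Real.one_le_sqrt]; nlinarith [Real.pi_gt_three]
  have h2 : Real.exp (-u ^ 2 / 2) ≤ 1 := by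
    rw [Real.exp_le_one_iff]; nlinarith [sq_nonneg u]
  have h3 : (Real.sqrt (2 * Real.pi))⁻¹ ≤ 1 := inv_le_one_of_one_le₀ h1
  exact mul_le_one₀ h3 (Real.exp_pos _).le h2

lemma aux_integrable : MeasureTheory.Integrable normalPdf := by
  have h := (integrable_exp_neg_mul_sq (b := 1/2) (by norm_num)).const_mul (Real.sqrt (2 * Real.pi))⁻¹
  convert h using 1
  funext u
  unfold normalPdf
  congr 2
  ring

lemma aux_pdf_deriv (u : ℝ) : HasDerivAt normalPdf (-u * normalPdf u) u := by
  have h1 : HasDerivAt (fun u : ℝ => -u ^ 2 / 2) (-u) u := by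
    have := ((hasDerivAt_pow 2 u).neg).div_const 2
    refine HasDerivAt.congr_deriv this ?_
    simp
    ring
  have h2 := (h1.exp).const_mul (Real.sqrt (2 * Real.pi))⁻¹
  unfold normalPdf
  refine HasDerivAt.congr_deriv h2 ?_
  ring

lemma aux_cdf_deriv (u : ℝ) : HasDerivAt normalCdf (normalPdf u) u := by
  have h : normalCdf = fun u => (∫ t in (0:ℝ)..u, normalPdf t) + normalCdf 0 := by
    funext u
    rw [← intervalIntegral.integral_Iic_sub_Iic aux_integrable.integrableOn
      aux_integrable.integrableOn]
    unfold normalCdf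
    ring
  rw [h]
  exact (intervalIntegral.integral_hasDerivAt_right (aux_integrable.intervalIntegrable)
    (aux_cont.stronglyMeasurableAtFilter _ _) aux_cont.continuousAt).add_const _

lemma aux_cdf_pos (u : ℝ) : 0 < normalCdf u := by
  have hm : StrictMono normalCdf := by
    apply strictMono_of_deriv_pos
    intro x
    rw [(aux_cdf_deriv x).deriv]
    exact aux_pos x
  have h0 : 0 ≤ normalCdf (u - 1) :=
    MeasureTheory.integral_nonneg fun t => (aux_pos t).le
  exact h0.trans_lt (hm (by linarith))

lemma aux_mills (u : ℝ) : 0 < normalCdf u + u * normalPdf u / (1 + u ^ 2) := by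
  have hm : StrictMono (fun u : ℝ => normalCdf u + u * normalPdf u / (1 + u ^ 2)) := by
    apply strictMono_of_deriv_pos
    intro x
    have hx : (1 + x ^ 2) ≠ 0 := by positivity
    have hd := (aux_cdf_deriv x).add ((((hasDerivAt_id x).mul (aux_pdf_deriv x))).div
      ((hasDerivAt_pow 2 x).const_add 1) hx)
    have hd2 : HasDerivAt (fun u : ℝ => normalCdf u + u * normalPdf u / (1 + u ^ 2))
        (2 * normalPdf x / (1 + x ^ 2) ^ 2) x := by
      refine HasDerivAt.congr_deriv hd ?_
      simp
      field_simp
      ring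
    rw [hd2.deriv]
    have := aux_pos x
    positivity
  have h0 : 0 ≤ normalCdf (u - 1) + (u - 1) * normalPdf (u - 1) / (1 + (u - 1) ^ 2) := by
    refine le_of_tendsto (tendsto_inv_atBot_zero (𝕜 := ℝ)) ?_
    filter_upwards [Filter.eventually_le_atBot (u - 1), Filter.eventually_lt_atBot 0] with v hv hv0
    refine le_trans ?_ (hm.monotone hv)
    have h1 := aux_cdf_pos v
    have h2 : v⁻¹ ≤ v * normalPdf v / (1 + v ^ 2) := by
      rw [le_div_iff₀ (by positivity)]
      have e : v⁻¹ * (1 + v ^ 2) = v⁻¹ + v := by field_simp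
      have : v⁻¹ < 0 := inv_lt_zero.2 hv0
      nlinarith [aux_le_one v]
    show _ ≤ normalCdf v + v * normalPdf v / (1 + v ^ 2)
    linarith
  exact h0.trans_lt (hm (by linarith : u - 1 < u))

lemma aux_anti : StrictAnti mesG := by
  apply strictAnti_of_deriv_neg
  intro x
  have hc := aux_cdf_pos x
  have hp := aux_pos x
  have hM := aux_mills x
  have hd := (((hasDerivAt_id x).mul (aux_pdf_deriv x)).div
      ((aux_cdf_deriv x).const_mul 2) (by positivity)).sub ((aux_cdf_deriv x).log hc.ne')
  have hd2 : HasDerivAt mesG (-(normalPdf x * (1 + x ^ 2) / (2 * normalCdf x ^ 2) *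
      (normalCdf x + x * normalPdf x / (1 + x ^ 2)))) x := by
    have hx : (1 + x ^ 2) ≠ 0 := by positivity
    refine HasDerivAt.congr_deriv hd ?_
    simp
    field_simp
    ring
  rw [hd2.deriv]
  have : 0 < normalPdf x * (1 + x ^ 2) / (2 * normalCdf x ^ 2) := by positivity
  have := mul_pos this hM
  linarith

/-- MES with a single sample `y⋆` selects exactly the same points as EST with `m = y⋆`:
a point `x` maximizes `g(γ(x))` over the finite set `X` iff it minimizes
`γ(x) = (y⋆ − μ(x))/σ(x)` over `X`. -/
theorem mes_single_sample_eq_est {X : Type*} [Fintype X] [Nonempty X]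
    (μ σ : X → ℝ) (hσ : ∀ x, 0 < σ x) (ystar : ℝ)
    (γ : X → ℝ) (hγ : ∀ x, γ x = (ystar - μ x) / σ x) (x : X) :
    (∀ x' : X, mesG (γ x') ≤ mesG (γ x)) ↔ (∀ x' : X, γ x ≤ γ x') := by
  simp only [aux_anti.le_iff_ge]
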